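/- A non-decreasing sequence (d_1, ..., d_n) of non-negative integers is the score sequence of some self-converse (non-generalised) tournament on n vertices if and only if it satisfies condition I (for every subset J of {1,...,n}, the sum of d_i over i in J is at least binom(|J|,2), with equality when J = {1,...,n}) and condition II (d_i + d_{n+1-i} = n - 1 for all i = 1,...,n). -/

import Mathlib

/-- A (non-generalised) tournament: a `{0,1}`-valued weight function with
`α u v + α v u = 1` for `u ≠ v` and `α v v = 0`. -/
def IsTournament {V : Type*} (α : V → V → ℝ) : Prop :=
  (∀ u v, α u v = 0 ∨ α u v = 1) ∧ (∀ u v, u ≠ v → α u v + α v u = 1) ∧ (∀ v, α v v = 0)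

/-- Self-converse: some bijection is an isomorphism onto the converse. -/
def IsSelfConverse {n : ℕ} (α : Fin n → Fin n → ℝ) : Prop :=
  ∃ ρ : Equiv.Perm (Fin n), ∀ i j, i ≠ j → α i j = 1 - α (ρ i) (ρ j)

/-- Symmetric integer tournament: `Fin.rev` is an anti-automorphism. -/
structure SymT {n : ℕ} (α : Fin n → Fin n → ℤ) : Prop where
  rng : ∀ u v, α u v = 0 ∨ α u v = 1
  add : ∀ u v, u ≠ v → α u v + α v u = 1
  diag : ∀ v, α v v = 0
  sym : ∀ u v, α v.rev u.rev = α u v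

def dl {n : ℕ} (a u : Fin n) : ℤ := if u = a then 1 else 0

def ar {n : ℕ} (a b u v : Fin n) : ℤ := dl a u * dl b v - dl b u * dl a v

def score {n : ℕ} (α : Fin n → Fin n → ℤ) (u : Fin n) : ℤ := ∑ v, α u v

lemma sum_dl {n : ℕ} (a : Fin n) : ∑ v, dl a v = 1 := by simp [dl]

lemma sum_ar {n : ℕ} (a b u : Fin n) : ∑ v, ar a b u v = dl a u - dl b u := by
  simp only [ar, Finset.sum_sub_distrib, ← Finset.mul_sum, sum_dl, mul_one]

lemma dl_rev {n : ℕ} (a u : Fin n) : dl a.rev u.rev = dl a u := by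
  simp [dl]

lemma dl_rev2 {n : ℕ} (a u : Fin n) : dl a u.rev = dl a.rev u := by
  rw [← dl_rev, Fin.rev_rev]

lemma symT_rev_score {n : ℕ} {α : Fin n → Fin n → ℤ} (h : SymT α) (u : Fin n) :
    score α u + score α u.rev = n - 1 := by
  have h1 : score α u.rev = ∑ v, α v u := by
    unfold score
    rw [← Equiv.sum_comp Fin.revPerm]
    apply Finset.sum_congr rfl
    intro v _
    exact h.sym v u
  rw [h1]
  unfold score
  rw [← Finset.sum_add_distrib]
  have : ∀ v, α u v + α v u = 1 - dl u v := by
    intro v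
    unfold dl
    split_ifs with e
    · subst e; simp [h.diag]
    · rw [h.add u v (Ne.symm e)]; simp
  simp only [this, Finset.sum_sub_distrib, sum_dl]
  simp

/-- flip of a self-mirror arc -/
lemma flip_self {n : ℕ} {α : Fin n → Fin n → ℤ} (h : SymT α) (a : Fin n)
    (hne : a ≠ a.rev) (ha : α a a.rev = 1) :
    ∃ α', SymT α' ∧ (∀ u, score α' u = score α u - dl a u + dl a.rev u) := by
  have hb : α a.rev a = 0 := by have := h.add _ _ hne; omega
  refine ⟨fun u v => α u v - ar a a.rev u v, ⟨?_, ?_, ?_, ?_⟩, ?_⟩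
  · intro u v
    have := h.rng u v
    simp only [ar, dl]
    grind
  · intro u v huv
    have := h.add u v huv
    simp only [ar]
    linarith
  · intro v
    simp only [ar, h.diag]
    ring
  · intro u v
    simp only [ar, h.sym, dl_rev2, Fin.rev_rev]
    ring
  · intro u
    simp only [score, Finset.sum_sub_distrib, sum_ar]
    ring

/-- flip of an arc and its mirror -/
lemma flip_pair {n : ℕ} {α : Fin n → Fin n → ℤ} (h : SymT α) (a b : Fin n)
    (hne : a ≠ b) (hne' : b ≠ a.rev) (ha : α a b = 1) :
    ∃ α', SymT α' ∧ (∀ u, score α' u = score α u - dl a u + dl b u + dl a.rev u - dl b.rev u) ∧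
      (∀ u v, ¬ (u = a ∧ v = b) → ¬ (u = b ∧ v = a) → ¬ (u = b.rev ∧ v = a.rev) →
        ¬ (u = a.rev ∧ v = b.rev) → α' u v = α u v) := by
  have hb : α b a = 0 := by have := h.add _ _ hne; omega
  have ha' : α b.rev a.rev = 1 := by rw [h.sym, ha]
  have hb' : α a.rev b.rev = 0 := by rw [h.sym, hb]
  have hr : a.rev ≠ b.rev := by simpa using hne
  have hr' : a ≠ b.rev := by intro e; apply hne'; rw [e, Fin.rev_rev]
  refine ⟨fun u v => α u v - ar a b u v - ar b.rev a.rev u v, ⟨?_, ?_, ?_, ?_⟩, ?_, ?_⟩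
  · intro u v
    have := h.rng u v
    simp only [ar, dl]
    grind
  · intro u v huv
    have := h.add u v huv
    simp only [ar]
    linarith
  · intro v
    simp only [ar, h.diag]
    ring
  · intro u v
    simp only [ar, h.sym, dl_rev2, Fin.rev_rev]
    ring
  · intro u
    simp only [score, Finset.sum_sub_distrib, sum_ar]
    ring
  · intro u v h1 h2 h3 h4
    simp only [ar, dl]
    grind

lemma two_path {n : ℕ} {α : Fin n → Fin n → ℤ} (h : SymT α) (b c : Fin n)
    (hs : score α b + 2 ≤ score α c) (hbc : α b c = 1) :
    ∃ l, l ≠ b ∧ l ≠ c ∧ l ≠ b.rev ∧ l ≠ c.rev ∧ α c l = 1 ∧ α l b = 1 := by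
  by_contra! hcon
  have hne : b ≠ c := by rintro rfl; omega
  have key : ∀ l, α c l ≤ α b l + dl b.rev l + dl c.rev l - dl c l := by
    intro l
    have h1 := h.rng c l
    have h2 := h.rng b l
    have h3 := h.rng l b
    have h4 := h.add b c hne
    have h5 := h.diag c
    have h6 := hcon l
    have h7 := h.add b l
    simp only [dl]
    grind
  have := Finset.sum_le_sum (fun l (_ : l ∈ Finset.univ) => key l)
  simp only [Finset.sum_sub_distrib, Finset.sum_add_distrib, sum_dl] at this
  unfold score at hs
  omega

lemma caseA {n : ℕ} {α : Fin n → Fin n → ℤ} (h : SymT α) (b c : Fin n)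
    (hs : score α b + 2 ≤ score α c) (hc : c = b.rev) :
    ∃ α', SymT α' ∧ ∀ u, score α' u = score α u - dl c u + dl b u := by
  have hne : b ≠ c := by rintro rfl; omega
  have hcb : c.rev = b := by rw [hc, Fin.rev_rev]
  rcases h.rng c b with h0 | h1
  · have hbc : α b c = 1 := by have := h.add b c hne; omega
    obtain ⟨l, l1, l2, l3, l4, l5, l6⟩ := two_path h b c hs hbc
    by_cases hl : l.rev = l
    · obtain ⟨α', s', hs', -⟩ := flip_pair h c l l2.symm l4 l5
      refine ⟨α', s', fun u => ?_⟩
      rw [hs', hl, hcb]; ring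
    · obtain ⟨α1, s1, hs1, e1⟩ := flip_pair h c l l2.symm l4 l5
      have x1 : α1 l b = 1 := by
        rw [e1 l b, l6] <;> grind
      obtain ⟨α2, s2, hs2, e2⟩ := flip_pair s1 l b l1 (by grind [Fin.rev_rev]) x1
      have x2 : α2 b b.rev = 1 := by
        rw [e2 b b.rev, e1 b b.rev, ← hc, hbc] <;> grind [Fin.rev_rev]
      obtain ⟨α3, s3, hs3⟩ := flip_self s2 b (by rwa [← hc]) x2
      refine ⟨α3, s3, fun u => ?_⟩
      rw [hs3, hs2, hs1, hcb, ← hc]; ring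
  · obtain ⟨α', s', hs'⟩ := flip_self h c (by rw [hcb]; exact hne.symm) (by rwa [hcb])
    refine ⟨α', s', fun u => ?_⟩
    rw [hs', hcb]

lemma caseB {n : ℕ} {α : Fin n → Fin n → ℤ} (h : SymT α) (b c : Fin n)
    (hs : score α b + 2 ≤ score α c) (hc : c ≠ b.rev) (hcc : c ≠ c.rev) (hbb : b ≠ b.rev) :
    ∃ α', SymT α' ∧ ∀ u, score α' u = score α u - dl c u + dl b u + dl c.rev u - dl b.rev u := by
  have hne : b ≠ c := by rintro rfl; omega
  have hc' : b ≠ c.rev := by rintro rfl; simp at hc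
  rcases h.rng c b with h0 | h1
  · have hbc : α b c = 1 := by have := h.add b c hne; omega
    obtain ⟨l, l1, l2, l3, l4, l5, l6⟩ := two_path h b c hs hbc
    obtain ⟨α1, s1, hs1, e1⟩ := flip_pair h c l l2.symm l4 l5
    have x1 : α1 l b = 1 := by
      rw [e1 l b, l6] <;> grind
    obtain ⟨α2, s2, hs2, e2⟩ := flip_pair s1 l b l1 (by grind [Fin.rev_rev]) x1
    refine ⟨α2, s2, fun u => ?_⟩
    rw [hs2, hs1]; ring
  · obtain ⟨α', s', hs', -⟩ := flip_pair h c b hne.symm hc' h1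
    exact ⟨α', s', hs'⟩

def pre {n : ℕ} (g : Fin n → ℤ) (k : ℕ) : ℤ := ∑ i, if i.val < k then g i else 0

lemma pre_zero {n : ℕ} (g : Fin n → ℤ) : pre g 0 = 0 := by simp [pre]

lemma pre_succ {n : ℕ} (g : Fin n → ℤ) (k : Fin n) : pre g (k.val + 1) = pre g k.val + g k := by
  have : g k = ∑ i, if i = k then g i else 0 := by simp
  rw [this]
  unfold pre
  rw [← Finset.sum_add_distrib]
  apply Finset.sum_congr rfl
  intro i _
  have : i = k ↔ i.val = k.val := Fin.ext_iff
  by_cases h1 : i.val < k.val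
  · have h2 : ¬ i = k := by omega
    simp [h1, h2, Nat.lt_succ_of_lt h1]
  · by_cases h2 : i = k
    · subst h2; simp
    · have : ¬ i.val < k.val + 1 := by omega
      simp [h1, h2, this]

lemma pre_rev {n : ℕ} (g : Fin n → ℤ) (hg : ∀ i, g i + g i.rev = 0) (k : ℕ) (hk : k ≤ n) :
    pre g (n - k) = pre g k := by
  have tot : ∑ i, g i = 0 := by
    have h1 : ∑ i : Fin n, g i.rev = ∑ i, g i := Equiv.sum_comp Fin.revPerm g
    have h2 : ∑ i : Fin n, (g i + g i.rev) = 0 := by simp [hg]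
    rw [Finset.sum_add_distrib] at h2
    omega
  have h1 : pre g (n - k) = ∑ i : Fin n, if i.rev.val < n - k then g i.rev else 0 :=
    (Equiv.sum_comp Fin.revPerm (fun i : Fin n => if i.val < n - k then g i else 0)).symm
  have h2 : pre g k - pre g (n - k) = ∑ i, g i := by
    rw [h1, pre, ← Finset.sum_sub_distrib]
    apply Finset.sum_congr rfl
    intro i _
    have := hg i
    have h3 : i.rev.val = n - (i.val + 1) := Fin.val_rev i
    have := i.isLt
    split_ifs <;> omega
  omega

lemma pre_dl {n : ℕ} (a : Fin n) (k : ℕ) : pre (dl a) k = if a.val < k then 1 else 0 := by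
  unfold pre dl
  rw [Finset.sum_eq_single a]
  · simp
  · intro b _ hb; simp [hb]
  · simp

lemma pre_add {n : ℕ} (f g : Fin n → ℤ) (k : ℕ) : pre (fun i => f i + g i) k = pre f k + pre g k := by
  unfold pre
  rw [← Finset.sum_add_distrib]
  apply Finset.sum_congr rfl
  intro i _
  split_ifs <;> simp

lemma pre_sub {n : ℕ} (f g : Fin n → ℤ) (k : ℕ) : pre (fun i => f i - g i) k = pre f k - pre g k := by
  unfold pre
  rw [← Finset.sum_sub_distrib]
  apply Finset.sum_congr rfl
  intro i _
  split_ifs <;> simp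

/-- one improvement step -/
lemma step {n : ℕ} (d : Fin n → ℤ) (hm : Monotone d) (hd : ∀ i, d i + d i.rev = n - 1)
    {α : Fin n → Fin n → ℤ} (h : SymT α)
    (hpos : ∀ k ≤ n, 0 ≤ pre (fun i => d i - score α i) k)
    (hne : ¬ ∀ i, score α i = d i) :
    ∃ α', SymT α' ∧ (∀ k ≤ n, 0 ≤ pre (fun i => d i - score α' i) k) ∧
      (∀ k ≤ n, pre (fun i => d i - score α' i) k ≤ pre (fun i => d i - score α i) k) ∧
      (∃ k ≤ n, pre (fun i => d i - score α' i) k < pre (fun i => d i - score α i) k) := by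
  set g : Fin n → ℤ := fun i => d i - score α i with hg
  have grev : ∀ i, g i + g i.rev = 0 := by
    intro i
    have h1 := symT_rev_score h i
    have h2 := hd i
    simp only [hg]; omega
  have frev := pre_rev g grev
  have f0 := pre_zero g
  have hex : ∃ k, k < n ∧ pre g (k + 1) ≠ 0 := by
    by_contra! hc
    apply hne
    intro i
    have h1 := hc i.val i.isLt
    have h2 : pre g i.val = 0 := by
      rcases Nat.eq_zero_or_pos i.val with h0 | h0
      · rw [h0, f0]
      · have := hc (i.val - 1) (by omega)
        rwa [Nat.sub_add_cancel h0] at this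
    have h3 := pre_succ g i
    simp only [hg] at h1 h2 h3
    omega
  classical
  let a := Nat.find hex
  obtain ⟨ha1, ha2⟩ : a < n ∧ pre g (a + 1) ≠ 0 := Nat.find_spec hex
  have hamin : ∀ k ≤ a, pre g k = 0 := by
    intro k hk
    rcases Nat.eq_zero_or_pos k with h0 | h0
    · rw [h0, f0]
    · have := Nat.find_min hex (m := k - 1) (by change k - 1 < a; omega)
      by_contra hcon
      apply this
      refine ⟨by omega, ?_⟩
      rwa [Nat.sub_add_cancel h0]
  have hapos : 0 < pre g (a + 1) := lt_of_le_of_ne (hpos _ ha1) (Ne.symm ha2)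
  have hna : pre g (n - a) = 0 := by rw [frev a ha1.le]; exact hamin a le_rfl
  have hlt : a + 1 < n - a := by
    by_contra hcon
    have h1 := frev (a + 1) ha1
    have h2 := hamin (n - (a + 1)) (by omega)
    omega
  have hex2 : ∃ k, a + 1 < k ∧ pre g k = 0 := ⟨n - a, hlt, hna⟩
  let b := Nat.find hex2
  obtain ⟨hb1, hb2⟩ : a + 1 < b ∧ pre g b = 0 := Nat.find_spec hex2
  have hbn : b ≤ n - a := Nat.find_min' hex2 ⟨hlt, hna⟩
  have hbmin : ∀ k, a < k → k < b → 0 < pre g k := by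
    intro k h1 h2
    rcases Nat.lt_or_ge (a + 1) k with h3 | h3
    · have := Nat.find_min hex2 h2
      have h4 := hpos k (by omega)
      have : pre g k ≠ 0 := fun h5 => this ⟨h3, h5⟩
      omega
    · have : k = a + 1 := by omega
      rw [this]; exact hapos
  clear_value a b
  have hnb : pre g (n - b) = 0 := by rw [frev b (by omega)]; exact hb2
  have hdich : n - b = a ∨ b ≤ n - b := by
    by_contra! hcon
    have := hbmin (n - b) (by omega) (by omega)
    omega
  let β : Fin n := ⟨a, ha1⟩
  let γ : Fin n := ⟨b - 1, by omega⟩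
  have vβ : β.val = a := rfl
  have vγ : γ.val = b - 1 := rfl
  have vβ' : β.rev.val = n - (a + 1) := Fin.val_rev β
  have vγ' : γ.rev.val = n - b := by rw [Fin.val_rev, vγ]; omega
  clear_value β γ
  have gβ : 0 < g β := by
    have := pre_succ g β
    rw [vβ, hamin a le_rfl] at this
    omega
  have gγ : g γ < 0 := by
    have := pre_succ g γ
    have h2 := hbmin (b - 1) (by omega) (by omega)
    rw [vγ, Nat.sub_add_cancel (by omega), hb2] at this
    omega
  have hdm : d β ≤ d γ := hm (by rw [Fin.le_def]; omega)
  have hs : score α β + 2 ≤ score α γ := by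
    simp only [hg] at gβ gγ
    omega
  rcases hdich with hA | hB
  · obtain ⟨α', s', hs'⟩ := caseA h β γ hs (by rw [Fin.ext_iff]; omega)
    have hp : ∀ k, pre (fun i => d i - score α' i) k = pre g k +
        (if b - 1 < k then 1 else 0) - (if a < k then 1 else 0) := by
      intro k
      have : (fun i => d i - score α' i) = fun i => (g i + dl γ i) - dl β i := by
        funext i; rw [hs']; simp only [hg]; ring
      rw [this, pre_sub, pre_add, pre_dl, pre_dl, vβ, vγ]
    refine ⟨α', s', ?_, ?_, a + 1, by omega, ?_⟩
    · intro k hk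
      rw [hp]
      have := hpos k hk
      have := hbmin k
      split_ifs <;> omega
    · intro k hk
      rw [hp]
      split_ifs <;> omega
    · rw [hp]
      split_ifs <;> omega
  · obtain ⟨α', s', hs'⟩ := caseB h β γ hs (by rw [Ne, Fin.ext_iff]; omega)
      (by rw [Ne, Fin.ext_iff]; omega) (by rw [Ne, Fin.ext_iff]; omega)
    have hp : ∀ k, pre (fun i => d i - score α' i) k = pre g k +
        (if b - 1 < k then 1 else 0) - (if a < k then 1 else 0)
        + (if n - (a + 1) < k then 1 else 0) - (if n - b < k then 1 else 0) := by
      intro k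
      have : (fun i => d i - score α' i) =
          fun i => (((g i + dl γ i) - dl β i) + dl β.rev i) - dl γ.rev i := by
        funext i; rw [hs']; simp only [hg]; ring
      rw [this, pre_sub, pre_add, pre_sub, pre_add, pre_dl, pre_dl, pre_dl, pre_dl,
        vβ, vγ, vβ', vγ']
    refine ⟨α', s', ?_, ?_, a + 1, by omega, ?_⟩
    · intro k hk
      rw [hp]
      have := hpos k hk
      have := hbmin k
      have := hbmin (n - k)
      have := frev k hk
      split_ifs <;> omega
    · intro k hk
      rw [hp]
      split_ifs <;> omega
    · rw [hp]
      split_ifs <;> omega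

lemma iter {n : ℕ} (d : Fin n → ℤ) (hm : Monotone d) (hd : ∀ i, d i + d i.rev = n - 1) (N : ℕ) :
    ∀ α : Fin n → Fin n → ℤ, SymT α →
    (∀ k ≤ n, 0 ≤ pre (fun i => d i - score α i) k) →
    (∑ k ∈ Finset.range (n + 1), pre (fun i => d i - score α i) k ≤ N) →
    ∃ α', SymT α' ∧ ∀ i, score α' i = d i := by
  induction N with
  | zero =>
    intro α h hp hN
    by_cases hne : ∀ i, score α i = d i
    · exact ⟨α, h, hne⟩
    · obtain ⟨α', s', h1, h2, k, hk, h3⟩ := step d hm hd h hp hne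
      exfalso
      have : ∑ k ∈ Finset.range (n + 1), pre (fun i => d i - score α' i) k <
          ∑ k ∈ Finset.range (n + 1), pre (fun i => d i - score α i) k :=
        Finset.sum_lt_sum (fun k hk => h2 k (by simp at hk; omega)) ⟨k, by simp; omega, h3⟩
      have : 0 ≤ ∑ k ∈ Finset.range (n + 1), pre (fun i => d i - score α' i) k :=
        Finset.sum_nonneg (fun k hk => h1 k (by simp at hk; omega))
      push_cast at hN
      omega
  | succ N ih =>
    intro α h hp hN
    by_cases hne : ∀ i, score α i = d i
    · exact ⟨α, h, hne⟩
    · obtain ⟨α', s', h1, h2, k, hk, h3⟩ := step d hm hd h hp hne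
      have : ∑ k ∈ Finset.range (n + 1), pre (fun i => d i - score α' i) k <
          ∑ k ∈ Finset.range (n + 1), pre (fun i => d i - score α i) k :=
        Finset.sum_lt_sum (fun k hk => h2 k (by simp at hk; omega)) ⟨k, by simp; omega, h3⟩
      apply ih α' s' h1
      push_cast at hN
      omega

lemma start {n : ℕ} : SymT (fun u v : Fin n => if v < u then (1 : ℤ) else 0) := by
  refine ⟨?_, ?_, ?_, ?_⟩
  · intro u v; split_ifs <;> simp
  · intro u v h
    rcases lt_or_gt_of_ne h with h1 | h1
    · simp [h1, h1.le]
    · simp [h1, h1.le]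
  · intro v; simp
  · intro u v; simp

lemma start_score {n : ℕ} (u : Fin n) :
    score (fun u v : Fin n => if v < u then (1 : ℤ) else 0) u = u.val := by
  simp [score, Finset.filter_gt_eq_Iio]

lemma pre_val {n : ℕ} (k : ℕ) (hk : k ≤ n) :
    pre (fun i : Fin n => (i.val : ℤ)) k = k.choose 2 := by
  induction k with
  | zero => simp [pre_zero]
  | succ k ih =>
    have h1 := pre_succ (fun i : Fin n => (i.val : ℤ)) ⟨k, hk⟩
    simp only at h1
    rw [h1, ih (by omega), Nat.choose_succ_succ' k 1]
    simp
    ring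

lemma sum_on {n : ℕ} {α : Fin n → Fin n → ℝ} (h : IsTournament α) (J : Finset (Fin n)) :
    ∑ i ∈ J, ∑ j ∈ J, α i j = (J.card.choose 2 : ℝ) := by
  have h1 : ∑ i ∈ J, ∑ j ∈ J, α i j = ∑ i ∈ J, ∑ j ∈ J, α j i := Finset.sum_comm
  have h2 : ∑ i ∈ J, ∑ j ∈ J, (α i j + α j i) = ∑ i ∈ J, ∑ j ∈ J, (1 - if i = j then (1:ℝ) else 0) := by
    apply Finset.sum_congr rfl
    intro i _
    apply Finset.sum_congr rfl
    intro j _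
    split_ifs with e
    · subst e; simp [h.2.2]
    · rw [h.2.1 i j e]; simp
  have h3 : ∑ i ∈ J, ∑ j ∈ J, (1 - if i = j then (1:ℝ) else 0) = J.card * (J.card - 1) := by
    have : ∀ i ∈ J, ∑ j ∈ J, (1 - if i = j then (1:ℝ) else 0) = (J.card - 1 : ℝ) := by
      intro i hi
      rw [Finset.sum_sub_distrib]
      simp [hi]
    rw [Finset.sum_congr rfl this]
    simp [mul_sub]
  simp only [Finset.sum_add_distrib] at h2
  rw [Nat.cast_choose_two]
  linarith

/-- Eplett's theorem: a non-decreasing sequence of non-negative integers is the score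
sequence of some self-converse tournament iff it satisfies condition I (subset sums are
at least `binom |J| 2`, with equality for the full set) and condition II
(`d i + d (n+1-i) = n - 1`, where `Fin.rev` plays the role of `i ↦ n+1-i`). -/
theorem eplett (n : ℕ) (d : Fin n → ℕ) (hmono : Monotone d) :
    (∃ α : Fin n → Fin n → ℝ, IsTournament α ∧ IsSelfConverse α ∧
      ∀ i, ∑ j, α i j = (d i : ℝ)) ↔
    ((∀ J : Finset (Fin n), J.card.choose 2 ≤ ∑ i ∈ J, d i) ∧
      (∑ i, d i = n.choose 2) ∧
      (∀ i : Fin n, d i + d i.rev = n - 1)) := by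
  constructor
  · rintro ⟨α, hα, ⟨ρ, hρ⟩, hs⟩
    refine ⟨?_, ?_, ?_⟩
    · intro J
      have : (J.card.choose 2 : ℝ) ≤ ∑ i ∈ J, (d i : ℝ) := by
        rw [← sum_on hα J]
        apply Finset.sum_le_sum
        intro i _
        rw [← hs]
        apply Finset.sum_le_sum_of_subset_of_nonneg (Finset.subset_univ _)
        intro j _ _
        rcases hα.1 i j with h | h <;> rw [h] <;> norm_num
      exact_mod_cast this
    · have := sum_on hα Finset.univ
      simp only [hs, Finset.card_univ, Fintype.card_fin] at this
      exact_mod_cast this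
    · have key : ∀ i, d i + d (ρ i) = n - 1 := by
        intro i
        have h1 : (d (ρ i) : ℝ) = ∑ j, α (ρ i) (ρ j) := by
          rw [← hs]; exact (Equiv.sum_comp ρ _).symm
        have h2 : (d i : ℝ) + d (ρ i) = n - 1 := by
          rw [h1, ← hs i, ← Finset.sum_add_distrib]
          have : ∀ j, α i j + α (ρ i) (ρ j) = 1 - if i = j then (1:ℝ) else 0 := by
            intro j
            split_ifs with e
            · subst e; simp [hα.2.2]
            · rw [hρ i j e]; ring
          simp [this, Finset.sum_sub_distrib]
        have : ((d i + d (ρ i) + 1 : ℕ) : ℝ) = n := by push_cast; linarith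
        have : d i + d (ρ i) + 1 = n := by exact_mod_cast this
        omega
      have m1 : Monotone (d ∘ (Fin.revPerm.trans ρ : Equiv.Perm (Fin n))) := by
        intro i j hij
        have h1 := key i.rev
        have h2 := key j.rev
        have h3 : d j.rev ≤ d i.rev := hmono (Fin.rev_le_rev.mpr hij)
        simp only [Function.comp, Equiv.trans_apply, Fin.revPerm_apply]
        omega
      have m2 : Monotone (d ∘ (Equiv.refl _ : Equiv.Perm (Fin n))) := by simpa using hmono
      have e := Tuple.unique_monotone m1 m2
      intro i
      have h1 := key i.rev
      have h2 := congrFun e i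
      simp only [Function.comp, Equiv.trans_apply, Fin.revPerm_apply, Equiv.refl_apply] at h2
      omega
  · rintro ⟨hJ, -, hII⟩
    have hm : Monotone (fun i => (d i : ℤ)) := fun i j h => by
      have := hmono h; dsimp only; omega
    have hd : ∀ i : Fin n, (d i : ℤ) + d i.rev = n - 1 := by
      intro i; have := hII i; have := i.isLt; omega
    have hp : ∀ k ≤ n, 0 ≤ pre (fun i => (d i : ℤ) -
        score (fun u v : Fin n => if v < u then (1 : ℤ) else 0) i) k := by
      intro k hk
      simp only [start_score]
      rw [pre_sub, pre_val k hk]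
      have h1 := hJ (Finset.univ.filter (fun i : Fin n => i.val < k))
      have h2 : (Finset.univ.filter (fun i : Fin n => i.val < k)).card = k := by
        rw [Fin.card_filter_val_lt]; omega
      rw [h2, Finset.sum_filter] at h1
      have h3 : pre (fun i => (d i : ℤ)) k =
          ((∑ i : Fin n, if i.val < k then d i else 0 : ℕ) : ℤ) := by
        unfold pre; push_cast; rfl
      rw [h3]
      have : ((k.choose 2 : ℕ) : ℤ) ≤ ((∑ i : Fin n, if i.val < k then d i else 0 : ℕ) : ℤ) := by
        exact_mod_cast h1
      linarith
    obtain ⟨α, hα, hs⟩ := iter (fun i => (d i : ℤ)) hm hd _ _ start hp (Int.self_le_toNat _)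
    refine ⟨fun i j => (α i j : ℝ), ⟨?_, ?_, ?_⟩, ⟨Fin.revPerm, ?_⟩, ?_⟩
    · intro u v
      rcases hα.rng u v with h | h <;> simp [h]
    · intro u v huv
      have := hα.add u v huv
      dsimp only
      exact_mod_cast this
    · intro v; simp [hα.diag]
    · intro i j hij
      have h1 := hα.add i j hij
      have h2 := hα.sym j i
      simp only [Fin.revPerm_apply, h2]
      have : (α i j : ℝ) + α j i = 1 := by exact_mod_cast h1
      linarith
    · intro i
      have := hs i
      unfold score at this
      dsimp only
      exact_mod_cast this
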